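/- arXiv:1107.4902 — 2 statements merged into one kernel-verified Lean document; each statement's English description precedes it below -/
import Mathlib

section
/- Fix the parameter m = 1000 in the definition of H_n and let t(n) = ⌈n^{0.8}⌉. Then P(H_n; t(n)), the proportion of solvable configurations among all configurations of size t(n) on H_n, tends to 1 as n → ∞. Consequently, for every α ∈ (0,1) and every sufficiently large n, τ_α(H_n) ≤ n^{0.8}; in particular τ_{1/2}(H_n) ∈ O(n^{0.8}). -/
open Finset

/-- A single pebbling move on `G`: remove two pebbles from a vertex `u` with at least
two pebbles and add one pebble to a vertex `v` adjacent to `u`. -/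
def PebblingMove {V : Type*} [DecidableEq V] (G : SimpleGraph V) (C C' : V → ℕ) : Prop :=
  ∃ u v : V, G.Adj u v ∧ 2 ≤ C u ∧
    C' = fun w => if w = u then C u - 2 else if w = v then C v + 1 else C w

/-- A configuration is solvable if every vertex can receive a pebble after finitely
many pebbling moves. -/
def Solvable {V : Type*} [DecidableEq V] (G : SimpleGraph V) (C : V → ℕ) : Prop :=
  ∀ v : V, ∃ C' : V → ℕ, Relation.ReflTransGen (PebblingMove G) C C' ∧ 1 ≤ C' v

/-- The pebbling number `π(G)`: the least `t` such that every configuration of size `t`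
is solvable. -/
noncomputable def pebblingNumber {V : Type*} [Fintype V] [DecidableEq V]
    (G : SimpleGraph V) : ℕ :=
  sInf {t : ℕ | ∀ C : V → ℕ, (∑ v, C v) = t → Solvable G C}

/-- The finset of all configurations of `t` pebbles on `n` vertices. -/
def configs (n t : ℕ) : Finset (Fin n → ℕ) :=
  (Fintype.piFinset fun _ : Fin n => Finset.range (t + 1)).filter fun C => ∑ i, C i = t

open scoped Classical in
/-- `P(G; t)`: the proportion of solvable configurations among all `C(n+t-1, t)`
configurations of size `t`. -/
noncomputable def solvableProportion (n : ℕ) (G : SimpleGraph (Fin n)) (t : ℕ) : ℝ :=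
  (((configs n t).filter fun C => Solvable G C).card : ℝ) / (Nat.choose (n + t - 1) t : ℝ)

/-- `τ_α(G)`: the least `t` with `P(G;t) ≥ α`. -/
noncomputable def tauAlpha (n : ℕ) (G : SimpleGraph (Fin n)) (α : ℝ) : ℕ :=
  sInf {t : ℕ | α ≤ solvableProportion n G t}

/-- A path on vertices `0, …, L-1` whose endpoint `L-1` is joined by an edge to vertex
`L` of the clique on vertices `L, …, n-1`. -/
def pathClique (n L : ℕ) : SimpleGraph (Fin n) :=
  SimpleGraph.fromRel fun i j =>
    (j.val = i.val + 1 ∧ j.val ≤ L) ∨ (L ≤ i.val ∧ L ≤ j.val)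

/-- `G_n`: a path with `⌊log₂ n⌋` vertices attached to a clique on the remaining vertices. -/
def Ggraph (n : ℕ) : SimpleGraph (Fin n) := pathClique n (Nat.log 2 n)

/-- Two disjoint paths on `0, …, L-1` and `L, …, 2L-1`, whose endpoints `L-1` and `2L-1`
are each joined by an edge to vertex `2L` of the clique on vertices `2L, …, n-1`. -/
def twoPathClique (n L : ℕ) : SimpleGraph (Fin n) :=
  SimpleGraph.fromRel fun i j =>
    (j.val = i.val + 1 ∧ j.val < L) ∨
    (L ≤ i.val ∧ j.val = i.val + 1 ∧ j.val < 2 * L) ∨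
    (2 * L ≤ i.val ∧ 2 * L ≤ j.val) ∨
    (i.val + 1 = L ∧ j.val = 2 * L) ∨
    (i.val + 1 = 2 * L ∧ j.val = 2 * L)

/-- `L' = ⌊(1/2)·log₂ n + m⌋`. -/
noncomputable def Lp (n m : ℕ) : ℕ := ⌊Real.logb 2 n / 2 + m⌋₊

/-- `H_n` with parameter `m`: two paths with `L'` vertices each, attached to a clique on
the remaining `n - 2L'` vertices. -/
noncomputable def Hgraph (n m : ℕ) : SimpleGraph (Fin n) := twoPathClique n (Lp n m)

section Reachability

variable {V : Type*} [DecidableEq V] {G : SimpleGraph V}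

/-- Repeatedly moving pebbles along one edge. -/
theorem exists_reachable_of_adj {u v : V} (h : G.Adj u v) (k : ℕ) (C : V → ℕ)
    (hk : 2 * k ≤ C u) :
    ∃ C' : V → ℕ, Relation.ReflTransGen (PebblingMove G) C C' ∧ C v + k ≤ C' v ∧
      ∀ w, w ≠ u → C w ≤ C' w := by
  induction k generalizing C with
  | zero => exact ⟨C, .refl, le_rfl, fun _ _ => le_rfl⟩
  | succ k ih =>
    have hvu : v ≠ u := h.ne'
    obtain ⟨C', hr, hv, hw⟩ := ih
      (fun w => if w = u then C u - 2 else if w = v then C v + 1 else C w)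
      (by simp only [if_true]; omega)
    refine ⟨C', .head ⟨u, v, h, by omega, rfl⟩ hr, ?_, fun w hwu => ?_⟩
    · simp only [hvu, if_true, if_false] at hv
      omega
    · have := hw w hwu
      simp only [hwu, if_false] at this
      split_ifs at this with hwv
      · subst hwv; omega
      · exact this

theorem exists_reachable_of_walk {u v : V} (p : G.Walk u v) (C : V → ℕ)
    (hC : 2 ^ p.length ≤ C u) :
    ∃ C' : V → ℕ, Relation.ReflTransGen (PebblingMove G) C C' ∧ 1 ≤ C' v := by
  induction p generalizing C with
  | nil => exact ⟨C, .refl, by simpa using hC⟩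
  | cons h p ih =>
    rw [SimpleGraph.Walk.length_cons, pow_succ'] at hC
    obtain ⟨C₁, hr₁, hv₁, -⟩ := exists_reachable_of_adj h _ C hC
    obtain ⟨C₂, hr₂, hv₂⟩ := ih C₁ (by omega)
    exact ⟨C₂, hr₁.trans hr₂, hv₂⟩

/-- Collecting on `r` half of the pebbles of each vertex in a set of neighbours of `r`. -/
theorem exists_reachable_of_neighbors {r : V} (S : Finset V) (hS : ∀ i ∈ S, G.Adj i r)
    (C : V → ℕ) :
    ∃ C' : V → ℕ, Relation.ReflTransGen (PebblingMove G) C C' ∧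
      C r + ∑ i ∈ S, C i / 2 ≤ C' r ∧ ∀ w, w ∉ S → C w ≤ C' w := by
  induction S using Finset.induction_on with
  | empty => exact ⟨C, .refl, by simp, fun _ _ => le_rfl⟩
  | insert a S ha ih =>
    obtain ⟨C₁, hr₁, hc₁, hw₁⟩ := ih fun i hi => hS i (Finset.mem_insert_of_mem hi)
    have haC := hw₁ a ha
    obtain ⟨C₂, hr₂, hc₂, hw₂⟩ := exists_reachable_of_adj
      (hS a (Finset.mem_insert_self a S)) (C a / 2) C₁ (by omega)
    refine ⟨C₂, hr₁.trans hr₂, ?_, fun w hw => ?_⟩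
    · rw [Finset.sum_insert ha]
      omega
    · rw [Finset.mem_insert, not_or] at hw
      exact (hw₁ w hw.2).trans (hw₂ w hw.1)

theorem solvable_of_hub {r : V} {d : ℕ} (hd : ∀ v, ∃ p : G.Walk r v, p.length ≤ d)
    (S : Finset V) (hS : ∀ i ∈ S, G.Adj i r) (C : V → ℕ) (hC : 2 ^ d ≤ ∑ i ∈ S, C i / 2) :
    Solvable G C := by
  intro v
  obtain ⟨p, hp⟩ := hd v
  obtain ⟨C₁, hr₁, hc₁, -⟩ := exists_reachable_of_neighbors S hS C
  have hpow : 2 ^ p.length ≤ 2 ^ d := Nat.pow_le_pow_right two_pos hp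
  obtain ⟨C₂, hr₂, hv₂⟩ := exists_reachable_of_walk p C₁ (by omega)
  exact ⟨C₂, hr₁.trans hr₂, hv₂⟩

end Reachability

theorem twoPathClique_adj_hub {n L : ℕ} (hL : 2 * L < n) (i : Fin n) (hi : 2 * L < i.val) :
    (twoPathClique n L).Adj i ⟨2 * L, hL⟩ := by
  rw [twoPathClique, SimpleGraph.fromRel_adj]
  refine ⟨fun h => by simp [h] at hi, Or.inl ?_⟩
  simp only
  omega

theorem twoPathClique_exists_walk_first {n L : ℕ} (hL : 2 * L < n) (j : ℕ) (hj : j < L) :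
    ∃ p : (twoPathClique n L).Walk ⟨2 * L, hL⟩ ⟨L - 1 - j, by omega⟩, p.length = j + 1 := by
  induction j with
  | zero =>
    have h : (twoPathClique n L).Adj ⟨2 * L, hL⟩ ⟨L - 1 - 0, by omega⟩ := by
      rw [twoPathClique, SimpleGraph.fromRel_adj]
      simp only [ne_eq, Fin.mk.injEq, and_true]
      omega
    exact ⟨h.toWalk, by simp⟩
  | succ j ih =>
    obtain ⟨p, hp⟩ := ih (by omega)
    have h : (twoPathClique n L).Adj ⟨L - 1 - j, by omega⟩
        ⟨L - 1 - (j + 1), by omega⟩ := by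
      rw [twoPathClique, SimpleGraph.fromRel_adj]
      simp only [ne_eq, Fin.mk.injEq]
      omega
    exact ⟨p.concat h, by simp [hp]⟩

theorem twoPathClique_exists_walk_second {n L : ℕ} (hL : 2 * L < n) (j : ℕ) (hj : j < L) :
    ∃ p : (twoPathClique n L).Walk ⟨2 * L, hL⟩ ⟨2 * L - 1 - j, by omega⟩,
      p.length = j + 1 := by
  induction j with
  | zero =>
    have h : (twoPathClique n L).Adj ⟨2 * L, hL⟩ ⟨2 * L - 1 - 0, by omega⟩ := by
      rw [twoPathClique, SimpleGraph.fromRel_adj]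
      simp only [ne_eq, Fin.mk.injEq, and_true]
      omega
    exact ⟨h.toWalk, by simp⟩
  | succ j ih =>
    obtain ⟨p, hp⟩ := ih (by omega)
    have h : (twoPathClique n L).Adj ⟨2 * L - 1 - j, by omega⟩
        ⟨2 * L - 1 - (j + 1), by omega⟩ := by
      rw [twoPathClique, SimpleGraph.fromRel_adj]
      simp only [ne_eq, Fin.mk.injEq]
      omega
    exact ⟨p.concat h, by simp [hp]⟩

theorem twoPathClique_exists_walk {n L : ℕ} (h₁ : 1 ≤ L) (hL : 2 * L < n) (v : Fin n) :
    ∃ p : (twoPathClique n L).Walk ⟨2 * L, hL⟩ v, p.length ≤ L := by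
  obtain ⟨v, hv⟩ := v
  rcases lt_or_ge v L with h | h
  · obtain ⟨p, hp⟩ := twoPathClique_exists_walk_first hL (L - 1 - v) (by omega)
    have hpv : L - 1 - (L - 1 - v) = v := by omega
    exact ⟨p.copy rfl (Fin.ext hpv), by simp only [SimpleGraph.Walk.length_copy]; omega⟩
  rcases lt_or_ge v (2 * L) with h' | h'
  · obtain ⟨p, hp⟩ := twoPathClique_exists_walk_second hL (2 * L - 1 - v) (by omega)
    have hpv : 2 * L - 1 - (2 * L - 1 - v) = v := by omega
    exact ⟨p.copy rfl (Fin.ext hpv), by simp only [SimpleGraph.Walk.length_copy]; omega⟩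
  rcases h'.eq_or_lt with rfl | h''
  · exact ⟨.nil, by simp⟩
  · exact ⟨(twoPathClique_adj_hub hL ⟨v, hv⟩ h'').symm.toWalk, by simpa using h₁⟩

theorem solvable_twoPathClique {n L : ℕ} (h₁ : 1 ≤ L) (hL : 2 * L < n) (C : Fin n → ℕ)
    (h₀ : ∀ i : Fin n, i.val ≤ 2 * L → C i = 0) (hC : 2 ^ L ≤ ∑ i, C i / 2) :
    Solvable (twoPathClique n L) C := by
  refine solvable_of_hub (twoPathClique_exists_walk h₁ hL)
    (Finset.univ.filter fun i : Fin n => 2 * L < i.val)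
    (fun i hi => twoPathClique_adj_hub hL i (by simpa using hi)) C (hC.trans_eq ?_)
  refine (Finset.sum_filter_of_ne fun i _ hi => ?_).symm
  by_contra h
  exact hi (by rw [h₀ i (by omega), Nat.zero_div])

theorem mem_configs {n t : ℕ} {C : Fin n → ℕ} : C ∈ configs n t ↔ ∑ i, C i = t := by
  rw [configs, Finset.mem_filter, Fintype.mem_piFinset, and_iff_right_iff_imp]
  intro h i
  rw [Finset.mem_range, Nat.lt_succ_iff, ← h]
  exact Finset.single_le_sum (fun _ _ => Nat.zero_le _) (Finset.mem_univ i)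

theorem card_configs (n t : ℕ) : (configs n t).card = n.multichoose t := by
  have e : (configs n t) ≃ Sym (Fin n) t :=
    (Equiv.subtypeEquivRight fun C => mem_configs).trans
      (Sym.equivNatSumOfFintype (Fin n) t).symm
  rw [← Fintype.card_coe, Fintype.card_congr e, Sym.card_sym_eq_multichoose, Fintype.card_fin]

theorem multichoose_succ_mul (n s : ℕ) :
    n.multichoose (s + 1) * (s + 1) = n.multichoose s * (n + s) := by
  rcases n with _ | n
  · rcases s with _ | s <;> simp [Nat.multichoose_zero_succ]
  · rw [Nat.multichoose_eq, Nat.multichoose_eq, show n + 1 + (s + 1) - 1 = n + s + 1 by omega,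
      show n + 1 + s - 1 = n + s by omega, ← Nat.add_one_mul_choose_eq]
    ring

/-- Configurations correspond to the halves of their values together with the set of
vertices carrying an odd number of pebbles. -/
theorem card_configs_half (n t s : ℕ) (hs : 2 * s ≤ t) :
    ((configs n t).filter fun C => ∑ i, C i / 2 = s).card =
      n.multichoose s * n.choose (t - 2 * s) := by
  have hcard : (Finset.powersetCard (t - 2 * s) (Finset.univ : Finset (Fin n))).card =
      n.choose (t - 2 * s) := by
    rw [Finset.card_powersetCard, Finset.card_univ, Fintype.card_fin]
  rw [← card_configs, ← hcard, ← Finset.card_product]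
  refine Finset.card_nbij'
    (fun C => (fun i => C i / 2, Finset.univ.filter fun i => C i % 2 = 1))
    (fun p i => 2 * p.1 i + if i ∈ p.2 then 1 else 0) ?_ ?_ ?_ ?_
  · intro C hC
    simp only [Finset.coe_filter, Set.mem_ofPred_eq, mem_configs] at hC
    simp only [Finset.coe_product, Set.mem_prod, Finset.mem_coe, mem_configs,
      Finset.mem_powersetCard, Finset.subset_univ, true_and]
    refine ⟨hC.2, ?_⟩
    have h : ∑ i, C i = 2 * ∑ i, C i / 2 + ∑ i, (if C i % 2 = 1 then 1 else 0) := by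
      rw [Finset.mul_sum, ← Finset.sum_add_distrib]
      refine Finset.sum_congr rfl fun i _ => ?_
      split_ifs <;> omega
    rw [Finset.card_filter]
    omega
  · rintro ⟨A, B⟩ h
    simp only [Finset.coe_product, Set.mem_prod, Finset.mem_coe, mem_configs,
      Finset.mem_powersetCard, Finset.subset_univ, true_and] at h
    simp only [Finset.coe_filter, Set.mem_ofPred_eq, mem_configs]
    constructor
    · rw [Finset.sum_add_distrib, ← Finset.mul_sum, h.1, Finset.sum_boole]
      simp only [Finset.filter_univ_mem, h.2, Nat.cast_id]
      omega
    · rw [← h.1]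
      refine Finset.sum_congr rfl fun i _ => ?_
      split_ifs <;> omega
  · intro C _
    funext i
    simp only [Finset.mem_filter, Finset.mem_univ, true_and]
    split_ifs <;> omega
  · rintro ⟨A, B⟩ _
    refine Prod.ext (funext fun i => ?_) (Finset.ext fun i => ?_)
    · simp only
      split_ifs <;> omega
    · simp only [Finset.mem_filter, Finset.mem_univ, true_and]
      split_ifs <;> simp_all

theorem four_mul_card_configs_half_succ (n t s : ℕ) (hs : 4 * s + 2 ≤ t) :
    t ^ 2 * (n.multichoose s * n.choose (t - 2 * s)) ≤
      4 * n * (s + 1) * (n.multichoose (s + 1) * n.choose (t - 2 * (s + 1))) := by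
  obtain ⟨k, rfl⟩ : ∃ k, t = k + 2 * s + 2 := ⟨t - 2 * s - 2, by omega⟩
  have e₁ : k + 2 * s + 2 - 2 * s = k + 1 + 1 := by omega
  have e₂ : k + 2 * s + 2 - 2 * (s + 1) = k := by omega
  rw [e₁, e₂]
  have h₁ := Nat.choose_succ_right_eq n k
  have h₂ := Nat.choose_succ_right_eq n (k + 1)
  have h₃ := multichoose_succ_mul n s
  have hk : k + 2 * s + 2 ≤ 2 * (k + 1) := by omega
  rcases Nat.eq_zero_or_pos n with rfl | hn
  · simp
  refine Nat.le_of_mul_le_mul_left ?_ hn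
  calc n * ((k + 2 * s + 2) ^ 2 * (n.multichoose s * n.choose (k + 1 + 1)))
      ≤ (n + s) * ((2 * (k + 1)) * (2 * (k + 1 + 1)) *
          (n.multichoose s * n.choose (k + 1 + 1))) := by
        rw [sq]; gcongr <;> omega
    _ = 4 * (n.multichoose s * (n + s)) * (n.choose (k + 1 + 1) * (k + 1 + 1)) * (k + 1) := by
        ring
    _ = 4 * (n.multichoose (s + 1) * (s + 1)) * (n.choose (k + 1) * (k + 1)) *
          (n - (k + 1)) := by rw [h₂, h₃]; ring
    _ = 4 * (n.multichoose (s + 1) * (s + 1)) * n.choose k * ((n - k) * (n - (k + 1))) := by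
        rw [h₁]; ring
    _ ≤ 4 * (n.multichoose (s + 1) * (s + 1)) * n.choose k * (n * n) := by
        gcongr <;> omega
    _ = _ := by ring

/-- Configurations with few pairs of pebbles are rare. -/
theorem card_configs_half_lt (n t M R : ℕ) (hn : 0 < n) (hM : 4 * M ≤ t)
    (hR : (R + 1) * (4 * n * M) ≤ t ^ 2) :
    R * ((configs n t).filter fun C => ∑ i, C i / 2 < M).card ≤
      (configs n t).card := by
  have key : ∀ s ≤ M, R * ((configs n t).filter fun C => ∑ i, C i / 2 < s).card ≤
      ((configs n t).filter fun C => ∑ i, C i / 2 = s).card := by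
    intro s
    induction s with
    | zero => simp
    | succ s ih =>
      intro hs
      have hsplit : ((configs n t).filter fun C => ∑ i, C i / 2 < s + 1).card =
          ((configs n t).filter fun C => ∑ i, C i / 2 < s).card +
          ((configs n t).filter fun C => ∑ i, C i / 2 = s).card := by
        rw [← Finset.card_union_of_disjoint, ← Finset.filter_or]
        · simp only [Nat.lt_succ_iff_lt_or_eq]
        · exact Finset.disjoint_filter.2 fun C _ h₁ h₂ => h₁.ne h₂
      have h := four_mul_card_configs_half_succ n t s (by omega)
      rw [← card_configs_half n t s (by omega), ← card_configs_half n t (s + 1) (by omega)] at h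
      have hle : (R + 1) * ((configs n t).filter fun C => ∑ i, C i / 2 = s).card ≤
          ((configs n t).filter fun C => ∑ i, C i / 2 = s + 1).card := by
        have hpos : 0 < 4 * n * M := Nat.mul_pos (by omega) (by omega)
        refine Nat.le_of_mul_le_mul_left ?_ hpos
        calc 4 * n * M * ((R + 1) * ((configs n t).filter fun C => ∑ i, C i / 2 = s).card)
            = (R + 1) * (4 * n * M) * ((configs n t).filter fun C => ∑ i, C i / 2 = s).card := by
              ring
          _ ≤ _ := (Nat.mul_le_mul_right _ hR).trans (h.trans (by gcongr))
      have := ih (by omega)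
      rw [hsplit]
      linarith
  exact (key M le_rfl).trans (Finset.card_filter_le _ _)

/-- Configurations with a pebble on a given vertex are rare. -/
theorem card_configs_pos (n t : ℕ) (i : Fin n) :
    n * ((configs n t).filter fun C => C i ≠ 0).card ≤ t * (configs n t).card := by
  rcases t with _ | t
  · have h : ((configs n 0).filter fun C => C i ≠ 0) = ∅ := by
      refine Finset.filter_eq_empty_iff.2 fun C hC => not_not.2 ?_
      exact Finset.sum_eq_zero_iff.1 (mem_configs.1 hC) i (Finset.mem_univ i)
    simp [h]
  have h : ((configs n (t + 1)).filter fun C => C i ≠ 0).card ≤ (configs n t).card := by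
    refine Finset.card_le_card_of_injOn (fun C => Function.update C i (C i - 1)) ?_ ?_
    · intro C hC
      simp only [Finset.coe_filter, Set.mem_ofPred_eq, mem_configs] at hC
      rw [Finset.mem_coe, mem_configs, Finset.sum_update_of_mem (Finset.mem_univ i)]
      have := Finset.add_sum_erase Finset.univ C (Finset.mem_univ i)
      rw [Finset.erase_eq] at this
      omega
    · intro C hC D hD hCD
      simp only [Finset.coe_filter, Set.mem_ofPred_eq] at hC hD
      funext j
      have := congrFun hCD j
      rcases eq_or_ne j i with rfl | hj
      · simp only [Function.update_self] at this
        omega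
      · simpa [hj] using this
  have h' := multichoose_succ_mul n t
  rw [← card_configs, ← card_configs] at h'
  nlinarith

open scoped Classical in
theorem card_not_solvable_twoPathClique (n t L R : ℕ) (h₁ : 1 ≤ L) (hL : 2 * L < n)
    (hM : 4 * 2 ^ L ≤ t) (hR : (R + 1) * (4 * n * 2 ^ L) ≤ t ^ 2)
    (ht : R * ((2 * L + 1) * t) ≤ n) :
    R * ((configs n t).filter fun C => ¬ Solvable (twoPathClique n L) C).card ≤
      2 * (configs n t).card := by
  have hn : 0 < n := by omega
  set I : Finset (Fin n) := Finset.univ.filter fun i => i.val ≤ 2 * L with hI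
  have hIcard : I.card ≤ 2 * L + 1 := by
    rw [← Finset.card_range (2 * L + 1)]
    refine Finset.card_le_card_of_injOn Fin.val (fun i hi => ?_) Fin.val_injective.injOn
    have : i.val ≤ 2 * L := by simpa [hI] using hi
    simpa using Nat.lt_succ_of_le this
  have hsub : ((configs n t).filter fun C => ¬ Solvable (twoPathClique n L) C) ⊆
      ((configs n t).filter fun C => ∑ i, C i / 2 < 2 ^ L) ∪
        I.biUnion fun i => (configs n t).filter fun C => C i ≠ 0 := by
    intro C hC
    rw [Finset.mem_filter] at hC
    rw [Finset.mem_union, or_iff_not_imp_left]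
    intro hnot
    by_contra hC₀
    refine hC.2 (solvable_twoPathClique h₁ hL C (fun i hi => ?_) ?_)
    · by_contra hi₀
      exact hC₀ (Finset.mem_biUnion.2 ⟨i, by simpa [hI] using hi,
        Finset.mem_filter.2 ⟨hC.1, hi₀⟩⟩)
    · by_contra hlt
      exact hnot (Finset.mem_filter.2 ⟨hC.1, by omega⟩)
  have hU : R * (I.biUnion fun i => (configs n t).filter fun C => C i ≠ 0).card ≤
      (configs n t).card := by
    refine Nat.le_of_mul_le_mul_left ?_ hn
    calc n * (R * (I.biUnion fun i => (configs n t).filter fun C => C i ≠ 0).card)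
        ≤ n * (R * ∑ i ∈ I, ((configs n t).filter fun C => C i ≠ 0).card) := by
          gcongr; exact Finset.card_biUnion_le
      _ = R * ∑ i ∈ I, n * ((configs n t).filter fun C => C i ≠ 0).card := by
          rw [← Finset.mul_sum]; ring
      _ ≤ R * ∑ _i ∈ I, t * (configs n t).card := by
          exact Nat.mul_le_mul_left R (Finset.sum_le_sum fun i _ => card_configs_pos n t i)
      _ = R * (I.card * t) * (configs n t).card := by
          rw [Finset.sum_const, smul_eq_mul]; ring
      _ ≤ R * ((2 * L + 1) * t) * (configs n t).card := by gcongr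
      _ ≤ n * (configs n t).card := by gcongr
  have hH := card_configs_half_lt n t (2 ^ L) R hn hM hR
  have := Nat.mul_le_mul_left R ((Finset.card_le_card hsub).trans (Finset.card_union_le _ _))
  rw [mul_add] at this
  omega

open scoped Classical in
theorem solvableProportion_eq (n t : ℕ) (G : SimpleGraph (Fin n)) :
    solvableProportion n G t =
      (((configs n t).filter fun C => Solvable G C).card : ℝ) / (configs n t).card := by
  rw [solvableProportion, card_configs, Nat.multichoose_eq]

open scoped Classical in
theorem solvableProportion_le_one (n t : ℕ) (G : SimpleGraph (Fin n)) :
    solvableProportion n G t ≤ 1 := by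
  rw [solvableProportion_eq]
  exact div_le_one_of_le₀ (by exact_mod_cast Finset.card_filter_le _ _) (Nat.cast_nonneg _)

open scoped Classical in
theorem one_sub_le_solvableProportion (n t R : ℕ) (G : SimpleGraph (Fin n)) (hn : 0 < n)
    (hR : 0 < R)
    (h : R * ((configs n t).filter fun C => ¬ Solvable G C).card ≤ 2 * (configs n t).card) :
    1 - 2 / (R : ℝ) ≤ solvableProportion n G t := by
  have hpos : 0 < (configs n t).card := by
    rw [card_configs, Nat.multichoose_eq]
    exact Nat.choose_pos (by omega)
  have hadd := Finset.card_filter_add_card_filter_not (s := configs n t) (fun C => Solvable G C)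
  have hposR : (0 : ℝ) < (configs n t).card := by exact_mod_cast hpos
  have hR' : (0 : ℝ) < R := by exact_mod_cast hR
  have h' : (R : ℝ) * ((configs n t).filter fun C => ¬ Solvable G C).card ≤
      2 * (configs n t).card := by exact_mod_cast h
  have hadd' : (((configs n t).filter fun C => Solvable G C).card : ℝ) +
      ((configs n t).filter fun C => ¬ Solvable G C).card = (configs n t).card := by
    exact_mod_cast hadd
  rw [solvableProportion_eq, le_div_iff₀ hposR, sub_mul, one_mul, div_mul_eq_mul_div,
    sub_le_comm, ← sub_nonneg]
  rw [← le_div_iff₀' hR'] at h'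
  linarith

theorem two_pow_Lp_le (n m : ℕ) (hn : 0 < n) :
    (2 : ℝ) ^ Lp n m ≤ 2 ^ m * (n : ℝ) ^ (1 / 2 : ℝ) := by
  have hn' : (0 : ℝ) < n := by exact_mod_cast hn
  have hlog : 0 ≤ Real.logb 2 n :=
    Real.logb_nonneg one_lt_two (by exact_mod_cast hn)
  calc (2 : ℝ) ^ Lp n m = (2 : ℝ) ^ (Lp n m : ℝ) := (Real.rpow_natCast _ _).symm
    _ ≤ (2 : ℝ) ^ (Real.logb 2 n / 2 + m) :=
        Real.rpow_le_rpow_of_exponent_le one_le_two (Nat.floor_le (by positivity))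
    _ = 2 ^ m * (n : ℝ) ^ (1 / 2 : ℝ) := by
        rw [Real.rpow_add two_pos, Real.rpow_natCast, mul_comm, div_eq_mul_one_div,
          Real.rpow_mul zero_le_two, Real.rpow_logb two_pos (by norm_num) hn']

theorem eventually_Lp_le_rpow (m : ℕ) {a : ℝ} (ha : 0 < a) :
    ∀ᶠ n : ℕ in Filter.atTop, (Lp n m : ℝ) ≤ (n : ℝ) ^ a := by
  have hlog : (fun x : ℝ => Real.logb 2 x / 2 + m) =o[Filter.atTop] fun x : ℝ => x ^ a := by
    refine Asymptotics.IsLittleO.add ?_ ?_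
    · have := (isLittleO_log_rpow_atTop ha).const_mul_left (1 / Real.log 2 / 2)
      refine this.congr_left fun x => ?_
      rw [Real.logb]; ring
    · exact Asymptotics.isLittleO_const_left.2 (Or.inr
        (tendsto_norm_atTop_atTop.comp (tendsto_rpow_atTop ha)))
  have h := (hlog.bound one_pos).and (Filter.eventually_ge_atTop (1 : ℝ))
  filter_upwards [tendsto_natCast_atTop_atTop.eventually h] with n hn
  have hl : 0 ≤ Real.logb 2 (n : ℝ) := Real.logb_nonneg one_lt_two hn.2
  have h₁ := (le_abs_self _).trans hn.1
  rw [one_mul, Real.norm_of_nonneg (by positivity)] at h₁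
  exact (Nat.floor_le (by positivity)).trans h₁

theorem le_Lp (n m : ℕ) (hn : 0 < n) : m ≤ Lp n m := by
  have hlog : 0 ≤ Real.logb 2 n :=
    Real.logb_nonneg one_lt_two (by exact_mod_cast hn)
  exact Nat.le_floor (by linarith)

theorem eventually_one_sub_le_solvableProportion (m R : ℕ) (hm : 1 ≤ m) (hR : 0 < R) :
    ∀ᶠ n : ℕ in Filter.atTop, ∀ t : ℕ, (n : ℝ) ^ (0.8 : ℝ) / 2 ≤ t →
      t ≤ 2 * (n : ℝ) ^ (0.8 : ℝ) → 1 - 2 / (R : ℝ) ≤ solvableProportion n (Hgraph n m) t := by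
  have hy := ((tendsto_rpow_atTop (show (0 : ℝ) < 0.1 by norm_num)).comp
    tendsto_natCast_atTop_atTop).eventually_ge_atTop (16 * (R + 1) * 2 ^ m)
  filter_upwards [hy, eventually_Lp_le_rpow m (show (0 : ℝ) < 0.1 by norm_num),
    Filter.eventually_gt_atTop 0] with n hy hL hn t ht₁ ht₂
  have hpow := two_pow_Lp_le n m hn
  have hn' : (0 : ℝ) ≤ n := Nat.cast_nonneg n
  have e₅ : (n : ℝ) ^ (1 / 2 : ℝ) = ((n : ℝ) ^ (0.1 : ℝ)) ^ 5 := by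
    rw [← Real.rpow_mul_natCast hn']; norm_num
  have e₈ : (n : ℝ) ^ (0.8 : ℝ) = ((n : ℝ) ^ (0.1 : ℝ)) ^ 8 := by
    rw [← Real.rpow_mul_natCast hn']; norm_num
  have e₁₀ : (n : ℝ) = ((n : ℝ) ^ (0.1 : ℝ)) ^ 10 := by
    rw [← Real.rpow_mul_natCast hn']; norm_num
  rw [e₈] at ht₁ ht₂
  rw [e₅] at hpow
  simp only [Function.comp_apply] at hy
  generalize (n : ℝ) ^ (0.1 : ℝ) = y at *
  have hR₁ : (1 : ℝ) ≤ R := by exact_mod_cast hR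
  have hm₁ : (1 : ℝ) ≤ 2 ^ m := one_le_pow₀ one_le_two
  have hyR : 16 * (R + 1 : ℝ) ≤ y := by nlinarith
  have hym : 16 * (2 : ℝ) ^ m ≤ y := by nlinarith
  have hy₁ : 1 ≤ y := by linarith
  have hy₀ : 0 ≤ y := by linarith
  refine one_sub_le_solvableProportion n t R _ hn hR
    (card_not_solvable_twoPathClique n t (Lp n m) R (hm.trans (le_Lp n m hn)) ?_ ?_ ?_ ?_)
  · have : 2 * (Lp n m : ℝ) < n := by
      calc 2 * (Lp n m : ℝ) ≤ 2 * y := by linarith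
        _ < y * y := by nlinarith
        _ = y ^ 2 := (sq y).symm
        _ ≤ y ^ 10 := pow_le_pow_right₀ hy₁ (by norm_num)
        _ = n := e₁₀.symm
    exact_mod_cast this
  · have : 4 * (2 : ℝ) ^ Lp n m ≤ t := by
      calc 4 * (2 : ℝ) ^ Lp n m ≤ 4 * (2 ^ m * y ^ 5) := by gcongr
        _ = 8 * 2 ^ m * y ^ 5 / 2 := by ring
        _ ≤ y * y ^ 5 / 2 := by gcongr; linarith
        _ = y ^ 6 / 2 := by ring
        _ ≤ y ^ 8 / 2 := by gcongr; norm_num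
        _ ≤ t := ht₁
    exact_mod_cast this
  · have : (R + 1 : ℝ) * (4 * n * 2 ^ Lp n m) ≤ t ^ 2 := by
      calc (R + 1 : ℝ) * (4 * n * 2 ^ Lp n m)
          ≤ (R + 1 : ℝ) * (4 * y ^ 10 * (2 ^ m * y ^ 5)) := by rw [e₁₀]; gcongr
        _ = 16 * (R + 1) * 2 ^ m * y ^ 15 / 4 := by ring
        _ ≤ y * y ^ 15 / 4 := by gcongr
        _ = (y ^ 8 / 2) ^ 2 := by ring
        _ ≤ t ^ 2 := by gcongr
    exact_mod_cast this
  · have : (R : ℝ) * ((2 * Lp n m + 1) * t) ≤ n := by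
      calc (R : ℝ) * ((2 * Lp n m + 1) * t) ≤ R * ((2 * y + y) * (2 * y ^ 8)) := by gcongr
        _ = 6 * R * y ^ 9 := by ring
        _ ≤ y * y ^ 9 := by gcongr; linarith
        _ = n := by rw [e₁₀]; ring
    exact_mod_cast this

theorem eventually_lt_solvableProportion {m : ℕ} (hm : 1 ≤ m) {a : ℝ} (ha : a < 1) :
    ∀ᶠ n : ℕ in Filter.atTop, ∀ t : ℕ, (n : ℝ) ^ (0.8 : ℝ) / 2 ≤ t →
      t ≤ 2 * (n : ℝ) ^ (0.8 : ℝ) → a < solvableProportion n (Hgraph n m) t := by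
  obtain ⟨R, hR⟩ := exists_nat_gt (2 / (1 - a))
  have ha' : 0 < 1 - a := sub_pos.2 ha
  have hR₀ : (0 : ℝ) < R := (div_pos two_pos ha').trans hR
  filter_upwards [eventually_one_sub_le_solvableProportion m R hm (by exact_mod_cast hR₀)]
    with n hn t ht₁ ht₂
  refine lt_of_lt_of_le ?_ (hn t ht₁ ht₂)
  rw [lt_sub_comm, div_lt_iff₀ hR₀, mul_comm]
  exact (div_lt_iff₀ ha').1 hR

/-- With `m = 1000` and `t(n) = ⌈n^{0.8}⌉`, the proportion
`P(H_n; t(n))` of solvable configurations tends to `1`; consequently for every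
`α ∈ (0,1)`, eventually `τ_α(H_n) ≤ n^{0.8}` (in particular `τ_{1/2}(H_n) ∈ O(n^{0.8})`). -/
theorem Hgraph_threshold_upper :
    Filter.Tendsto (fun n : ℕ => solvableProportion n (Hgraph n 1000) ⌈(n : ℝ) ^ (0.8 : ℝ)⌉₊)
        Filter.atTop (nhds 1) ∧
      ∀ α : ℝ, 0 < α → α < 1 →
        ∀ᶠ n : ℕ in Filter.atTop,
          (tauAlpha n (Hgraph n 1000) α : ℝ) ≤ (n : ℝ) ^ (0.8 : ℝ) := by
  have hpow : ∀ᶠ n : ℕ in Filter.atTop, (2 : ℝ) ≤ (n : ℝ) ^ (0.8 : ℝ) :=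
    ((tendsto_rpow_atTop (show (0 : ℝ) < 0.8 by norm_num)).comp
      tendsto_natCast_atTop_atTop).eventually_ge_atTop 2
  refine ⟨tendsto_order.2 ⟨fun a ha => ?_, fun a ha => ?_⟩, fun α _ hα => ?_⟩
  · filter_upwards [hpow, eventually_lt_solvableProportion (m := 1000) (by norm_num) ha]
      with n hn h
    refine h _ ?_ ?_
    · linarith [Nat.le_ceil ((n : ℝ) ^ (0.8 : ℝ))]
    · linarith [Nat.ceil_lt_add_one (show 0 ≤ (n : ℝ) ^ (0.8 : ℝ) by linarith)]
  · exact Filter.Eventually.of_forall fun n => (solvableProportion_le_one _ _ _).trans_lt ha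
  · filter_upwards [hpow, eventually_lt_solvableProportion (m := 1000) (by norm_num) hα]
      with n hn h
    have hfl := Nat.floor_le (show 0 ≤ (n : ℝ) ^ (0.8 : ℝ) by linarith)
    refine le_trans (Nat.cast_le.2 (Nat.sInf_le ?_)) hfl
    refine (h ⌊(n : ℝ) ^ (0.8 : ℝ)⌋₊ ?_ (by linarith)).le
    linarith [Nat.lt_floor_add_one ((n : ℝ) ^ (0.8 : ℝ))]
end

section
/- Let G'_n be the modified graph in which the path has L = ⌊log₂ n + log₂ log₂ n⌋ vertices and the complete graph has n − L vertices (joined by a single edge between the last path vertex and one fixed vertex of the complete graph). Then the pebbling threshold satisfies τ_{1/2}(G'_n)/n → ∞ as n → ∞; that is, for every constant c > 0, for all sufficiently large n the proportion of solvable configurations of size ⌊cn⌋ on G'_n is less than 1/2. -/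
open Finset

section Counting

theorem card_piAntidiag_nat {ι : Type*} [DecidableEq ι] (s : Finset ι) (t : ℕ) :
    (s.piAntidiag t).card = (s.card + t - 1).choose t := by
  rw [← card_finsuppAntidiag_nat_eq_choose]
  refine (card_bij (fun (f : ι →₀ ℕ) _ => (f : ι → ℕ)) ?_ (fun _ _ _ _ h => DFunLike.coe_injective h) ?_).symm
  · intro f hf
    rw [mem_finsuppAntidiag] at hf
    rw [mem_piAntidiag]
    exact ⟨hf.1, fun i hi => hf.2 (Finsupp.mem_support_iff.2 hi)⟩
  · intro g hg
    rw [mem_piAntidiag] at hg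
    refine ⟨Finsupp.onFinset s g hg.2, ?_, rfl⟩
    rw [mem_finsuppAntidiag]
    exact ⟨hg.1, Finsupp.support_onFinset_subset⟩

theorem configs_eq_piAntidiag (n t : ℕ) : configs n t = (univ : Finset (Fin n)).piAntidiag t := by
  ext C
  simp only [configs, mem_filter, Fintype.mem_piFinset, mem_range, mem_piAntidiag, mem_univ,
    implies_true, and_true, and_iff_right_iff_imp]
  intro h i
  have := single_le_sum (f := C) (fun _ _ => Nat.zero_le _) (mem_univ i)
  omega

theorem piAntidiag_inter {ι : Type*} [Fintype ι] [DecidableEq ι] (s s' : Finset ι) (t : ℕ) :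
    s.piAntidiag t ∩ s'.piAntidiag t = (s ∩ s').piAntidiag t := by
  ext f
  simp only [mem_inter, mem_piAntidiag]
  have key (u u' : Finset ι) (hf : ∀ i, f i ≠ 0 → i ∈ u ∧ i ∈ u') :
      (u ∩ u').sum f = u.sum f := by
    refine sum_subset inter_subset_left fun i hi hi' => ?_
    by_contra h
    exact hi' (mem_inter.2 (hf i h))
  constructor
  · rintro ⟨⟨h1, h2⟩, -, h4⟩
    exact ⟨(key s s' fun i hi => ⟨h2 i hi, h4 i hi⟩).trans h1, fun i hi => ⟨h2 i hi, h4 i hi⟩⟩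
  · rintro ⟨h1, h2⟩
    refine ⟨⟨(key s s' h2).symm.trans h1, fun i hi => (h2 i hi).1⟩, ?_, fun i hi => (h2 i hi).2⟩
    rw [← key s' s fun i hi => (h2 i hi).symm, inter_comm, h1]

theorem card_mul_sum_piAntidiag {ι : Type*} [DecidableEq ι] (s : Finset ι) (t : ℕ) {j : ι}
    (hj : j ∈ s) : s.card * ∑ C ∈ s.piAntidiag t, C j = t * (s.piAntidiag t).card := by
  have swap_mem (k : ι) (hk : k ∈ s) (C : ι → ℕ) (hC : C ∈ s.piAntidiag t) :
      C ∘ Equiv.swap j k ∈ s.piAntidiag t := by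
    have hmem (i : ι) : Equiv.swap j k i ∈ s ↔ i ∈ s := by
      rw [Equiv.swap_apply_def]
      split_ifs with h1 h2
      · simp [h1, hj, hk]
      · simp [h2, hj, hk]
      · rfl
    rw [mem_piAntidiag] at hC ⊢
    refine ⟨?_, fun i hi => (hmem i).1 (hC.2 _ hi)⟩
    rw [← hC.1]
    exact sum_equiv (Equiv.swap j k) (fun i => (hmem i).symm) fun _ _ => rfl
  have key (k : ι) (hk : k ∈ s) :
      ∑ C ∈ s.piAntidiag t, C k = ∑ C ∈ s.piAntidiag t, C j := by
    refine sum_nbij' (fun C => C ∘ Equiv.swap j k) (fun C => C ∘ Equiv.swap j k)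
      (swap_mem k hk) (swap_mem k hk) ?_ ?_ ?_
    · intro C _; ext i; simp
    · intro C _; ext i; simp
    · intro C _; simp
  calc s.card * ∑ C ∈ s.piAntidiag t, C j
      = ∑ k ∈ s, ∑ C ∈ s.piAntidiag t, C k := by
        rw [sum_congr rfl key, sum_const, smul_eq_mul]
    _ = ∑ C ∈ s.piAntidiag t, ∑ k ∈ s, C k := sum_comm
    _ = t * (s.piAntidiag t).card := by
        rw [sum_congr rfl fun C hC => (mem_piAntidiag.1 hC).1, sum_const, smul_eq_mul, mul_comm]

/-- Moving from `a` to `a + 1` parts multiplies the number of weak compositions by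
`(a + t) / a`. -/
theorem add_mul_choose_parts {a : ℕ} (ha : 1 ≤ a) (t : ℕ) :
    (a + t) * (a + t - 1).choose t = a * (a + 1 + t - 1).choose t := by
  obtain ⟨b, rfl⟩ : ∃ b, a = b + 1 := ⟨a - 1, by omega⟩
  have h := Nat.choose_mul_succ_eq (b + t) t
  rw [show b + t + 1 - t = b + 1 by omega] at h
  rw [show b + 1 + t - 1 = b + t by omega, show b + 1 + 1 + t - 1 = b + t + 1 by omega,
    show b + 1 + t = b + t + 1 by omega]
  linarith

theorem choose_parts_pos {a : ℕ} (ha : 1 ≤ a) (t : ℕ) : 0 < (a + t - 1).choose t :=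
  Nat.choose_pos (by omega)

theorem choose_parts_mul_le_succ {a b : ℕ} (ha : 1 ≤ a) (hab : a ≤ b) (t : ℕ) :
    (a + t - 1).choose t * (b + 1 + t - 1).choose t ≤
      (a + 1 + t - 1).choose t * (b + t - 1).choose t := by
  have h1 := add_mul_choose_parts ha t
  have h2 := add_mul_choose_parts (ha.trans hab) t
  set p := (a + t - 1).choose t
  set q := (b + t - 1).choose t
  set p' := (a + 1 + t - 1).choose t
  set q' := (b + 1 + t - 1).choose t
  have hpos : 0 < a * b := Nat.mul_pos ha (ha.trans hab)
  refine Nat.le_of_mul_le_mul_left ?_ hpos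
  calc a * b * (p * q') = a * p * (b * q') := by ring
    _ = a * (b + t) * (p * q) := by rw [← h2]; ring
    _ ≤ b * (a + t) * (p * q) := by
        refine Nat.mul_le_mul_right _ ?_
        nlinarith
    _ = b * q * ((a + t) * p) := by ring
    _ = a * b * (p' * q) := by rw [h1]; ring

/-- Log-concavity in the number of parts. -/
theorem choose_parts_mul_le {a b : ℕ} (ha : 1 ≤ a) (hab : a ≤ b) (t r : ℕ) :
    (a + t - 1).choose t * (b + r + t - 1).choose t ≤
      (a + r + t - 1).choose t * (b + t - 1).choose t := by
  induction r with
  | zero => simp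
  | succ r ih =>
    have h1 := choose_parts_mul_le_succ (a := a + r) (b := b + r) (by omega) (by omega) t
    have hpos := choose_parts_pos (a := a + r) (by omega) t
    have hpos' := choose_parts_pos (a := b + r) (by omega) t
    simp only [← add_assoc] at *
    set A := (a + t - 1).choose t
    set B := (b + t - 1).choose t
    set Ar := (a + r + t - 1).choose t
    set Br := (b + r + t - 1).choose t
    set Ar1 := (a + r + 1 + t - 1).choose t
    set Br1 := (b + r + 1 + t - 1).choose t
    refine Nat.le_of_mul_le_mul_left ?_ (Nat.mul_pos hpos hpos')
    calc Ar * Br * (A * Br1) = (A * Br) * (Ar * Br1) := by ring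
      _ ≤ (Ar * B) * (Ar1 * Br) := Nat.mul_le_mul ih h1
      _ = Ar * Br * (Ar1 * B) := by ring

theorem pow_mul_choose_parts_le {a t : ℕ} {D : ℝ} (ha : 1 ≤ a) (hD : (a + t : ℝ) ≤ D * a)
    (s : ℕ) : ((a + s + t - 1).choose t : ℝ) ≤ D ^ s * (a + t - 1).choose t := by
  have ha' : (0 : ℝ) < a := by exact_mod_cast ha
  have hD1 : 1 ≤ D := by
    have ht : (0 : ℝ) ≤ t := Nat.cast_nonneg t
    by_contra! h
    nlinarith
  induction s with
  | zero => simp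
  | succ s ih =>
    have h := add_mul_choose_parts (a := a + s) (by omega) t
    have hR : ((a + s : ℕ) + t : ℝ) * ((a + s + t - 1).choose t : ℝ) =
        (a + s : ℕ) * ((a + s + 1 + t - 1).choose t : ℝ) := by exact_mod_cast h
    have has : (0 : ℝ) < (a + s : ℕ) := by positivity
    have hle : ((a + s : ℕ) + t : ℝ) ≤ D * (a + s : ℕ) := by
      push_cast
      have : (0 : ℝ) ≤ s := Nat.cast_nonneg s
      nlinarith
    have hstep : ((a + s + 1 + t - 1).choose t : ℝ) ≤ D * (a + s + t - 1).choose t := by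
      refine le_of_mul_le_mul_left ?_ has
      rw [← hR]
      calc _ ≤ D * (a + s : ℕ) * ((a + s + t - 1).choose t : ℝ) :=
            mul_le_mul_of_nonneg_right hle (Nat.cast_nonneg _)
        _ = _ := by ring
    calc _ ≤ D * ((a + s + t - 1).choose t : ℝ) := hstep
      _ ≤ D * (D ^ s * (a + t - 1).choose t) := by gcongr
      _ = _ := by ring

/-- Second moment bound for the size of a union. -/
theorem sq_sum_card_le_card_biUnion {ι α : Type*} [DecidableEq α] (I : Finset ι)
    (G : ι → Finset α) :
    (∑ i ∈ I, (G i).card) ^ 2 ≤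
      (I.biUnion G).card * ∑ i ∈ I, ∑ j ∈ I, (G i ∩ G j).card := by
  set U := I.biUnion G
  have hsub (i : ι) (hi : i ∈ I) : G i ⊆ U := subset_biUnion_of_mem G hi
  have hcard (S : Finset α) (hS : S ⊆ U) : S.card = ∑ x ∈ U, if x ∈ S then 1 else 0 := by
    rw [sum_boole, filter_mem_eq_inter, inter_eq_right.2 hS]
    simp
  have h1 : ∑ i ∈ I, (G i).card = ∑ x ∈ U, ∑ i ∈ I, if x ∈ G i then 1 else 0 := by
    rw [sum_comm]
    exact sum_congr rfl fun i hi => hcard _ (hsub i hi)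
  have h2 : ∑ i ∈ I, ∑ j ∈ I, (G i ∩ G j).card =
      ∑ x ∈ U, (∑ i ∈ I, if x ∈ G i then 1 else 0) ^ 2 := by
    simp_rw [sq, sum_mul_sum]
    rw [sum_comm (s := U)]
    refine sum_congr rfl fun i hi => ?_
    rw [sum_comm (s := U)]
    refine sum_congr rfl fun j _ => ?_
    rw [hcard (G i ∩ G j) (inter_subset_left.trans (hsub i hi))]
    refine sum_congr rfl fun x _ => ?_
    by_cases h : x ∈ G i <;> by_cases h' : x ∈ G j <;> simp [h, h']
  rw [h1, h2]
  have := sum_mul_sq_le_sq_mul_sq U (fun _ => (1 : ℕ))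
    fun x => ∑ i ∈ I, if x ∈ G i then (1 : ℕ) else 0
  simpa using this

end Counting

section Pebbling

theorem weight_pebblingMove_le {V : Type*} [Fintype V] [DecidableEq V] {G : SimpleGraph V}
    {w : V → ℝ} (hw : ∀ u v, G.Adj u v → w v ≤ 2 * w u) {C C' : V → ℕ}
    (h : PebblingMove G C C') : ∑ x, w x * C' x ≤ ∑ x, w x * C x := by
  obtain ⟨u, v, huv, h2, rfl⟩ := h
  have hne : v ≠ u := huv.ne'
  have hpt (x : V) : w x * ((if x = u then C u - 2 else if x = v then C v + 1 else C x : ℕ) : ℝ) =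
      w x * C x + ((if x = u then -2 * w u else 0) + if x = v then w v else 0) := by
    rcases eq_or_ne x u with rfl | hxu
    · simp only [if_true, if_neg hne.symm, Nat.cast_sub h2]
      push_cast
      ring
    · rcases eq_or_ne x v with rfl | hxv
      · simp only [if_neg hxu, if_true]
        push_cast
        ring
      · simp [hxu, hxv]
  simp only [hpt, sum_add_distrib, sum_ite_eq', mem_univ, if_true]
  have := hw u v huv
  linarith

theorem one_le_weight_of_solvable {V : Type*} [Fintype V] [DecidableEq V] {G : SimpleGraph V}
    {w : V → ℝ} (hw0 : ∀ u, 0 ≤ w u) (hw : ∀ u v, G.Adj u v → w v ≤ 2 * w u) {v : V}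
    (hv : 1 ≤ w v) {C : V → ℕ} (h : Solvable G C) : 1 ≤ ∑ x, w x * C x := by
  obtain ⟨C', hC', h1⟩ := h v
  have hle : ∑ x, w x * C' x ≤ ∑ x, w x * C x := by
    clear h1
    induction hC' with
    | refl => exact le_rfl
    | tail _ hstep ih => exact (weight_pebblingMove_le hw hstep).trans ih
  have h1' : (1 : ℝ) ≤ C' v := by exact_mod_cast h1
  calc (1 : ℝ) ≤ w v * C' v := one_le_mul_of_one_le_of_one_le hv h1'
    _ ≤ ∑ x, w x * C' x :=
      single_le_sum (f := fun x => w x * (C' x : ℝ))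
        (fun x _ => mul_nonneg (hw0 x) (Nat.cast_nonneg _)) (mem_univ v)
    _ ≤ _ := hle

theorem exists_pebbles_of_adj {V : Type*} [DecidableEq V] {G : SimpleGraph V} {u v : V}
    (huv : G.Adj u v) (k : ℕ) : ∀ C : V → ℕ, 2 * k ≤ C u →
      ∃ C', Relation.ReflTransGen (PebblingMove G) C C' ∧ C v + k ≤ C' v := by
  induction k with
  | zero => exact fun C _ => ⟨C, .refl, by simp⟩
  | succ k ih =>
    intro C hC
    obtain ⟨C', hC', h⟩ := ih (fun w => if w = u then C u - 2 else if w = v then C v + 1 else C w)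
      (by simp only [if_true]; omega)
    refine ⟨C', .head ⟨u, v, huv, by omega, rfl⟩ hC', ?_⟩
    simp only [if_neg huv.ne', if_true] at h
    omega

theorem exists_pebbles_of_walk {V : Type*} [DecidableEq V] {G : SimpleGraph V} {u v : V}
    (p : G.Walk u v) : ∀ (k : ℕ) (C : V → ℕ), k * 2 ^ p.length ≤ C u →
      ∃ C', Relation.ReflTransGen (PebblingMove G) C C' ∧ k ≤ C' v := by
  induction p with
  | nil => exact fun k C hC => ⟨C, .refl, by simpa using hC⟩
  | cons h p ih =>
    intro k C hC
    rw [SimpleGraph.Walk.length_cons, pow_succ] at hC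
    obtain ⟨C₁, h₁, h₁'⟩ := exists_pebbles_of_adj h (k * 2 ^ p.length) C (by linarith)
    obtain ⟨C₂, h₂, h₂'⟩ := ih k C₁ (by omega)
    exact ⟨C₂, h₁.trans h₂, h₂'⟩

theorem solvable_of_preconnected {V : Type*} [Fintype V] [DecidableEq V] [Nonempty V]
    {G : SimpleGraph V} (hG : G.Preconnected) {C : V → ℕ}
    (hC : Fintype.card V * 2 ^ Fintype.card V ≤ ∑ v, C v) : Solvable G C := by
  intro v
  obtain ⟨u, -, hu⟩ : ∃ u ∈ (univ : Finset V), 2 ^ Fintype.card V ≤ C u :=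
    exists_le_of_sum_le univ_nonempty (by simpa using hC)
  obtain ⟨p, hp⟩ := hG.exists_isPath u v
  refine exists_pebbles_of_walk p 1 C (le_trans ?_ hu)
  rw [one_mul]
  exact Nat.pow_le_pow_right (by norm_num) hp.length_lt.le

theorem pathClique_preconnected (n L : ℕ) : (pathClique n L).Preconnected := by
  refine (SimpleGraph.pathGraph_preconnected n).mono fun u v h => ?_
  rw [SimpleGraph.pathGraph_adj] at h
  rw [pathClique, SimpleGraph.fromRel_adj]
  refine ⟨fun e => by subst e; omega, by omega⟩

theorem solvableProportion_eq_one {n : ℕ} (hn : 1 ≤ n) {G : SimpleGraph (Fin n)}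
    (hG : G.Preconnected) : solvableProportion n G (n * 2 ^ n) = 1 := by
  classical
  have : NeZero n := ⟨by omega⟩
  rw [solvableProportion, filter_true_of_mem, configs_eq_piAntidiag, card_piAntidiag_nat,
    card_univ, Fintype.card_fin]
  · exact div_self (by exact_mod_cast (choose_parts_pos hn _).ne')
  · intro C hC
    refine solvable_of_preconnected hG ?_
    rw [configs, mem_filter] at hC
    rw [Fintype.card_fin, hC.2]

end Pebbling

section Threshold

/-- A weight that no pebbling move on `pathClique n L` increases, for the target vertex `i`. -/
noncomputable def pathWeight (L i j : ℕ) : ℝ := (1 / 2) ^ ((i - j) + (j - i)) + (1 / 2) ^ (L - i)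

theorem pathWeight_nonneg (L i j : ℕ) : 0 ≤ pathWeight L i j := by
  unfold pathWeight
  positivity

theorem one_le_pathWeight_self (L i : ℕ) : 1 ≤ pathWeight L i i := by
  have : (0 : ℝ) ≤ (1 / 2) ^ (L - i) := by positivity
  simp [pathWeight]

theorem half_pow_le {a b : ℕ} (h : b ≤ a) : (1 / 2 : ℝ) ^ a ≤ (1 / 2) ^ b :=
  pow_le_pow_of_le_one (by norm_num) (by norm_num) h

theorem pathWeight_le_two_mul {n L i : ℕ} (hi : i ≤ L) {u v : Fin n}
    (h : (pathClique n L).Adj u v) : pathWeight L i v ≤ 2 * pathWeight L i u := by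
  have h0 (a : ℕ) : (0 : ℝ) ≤ (1 / 2) ^ a := by positivity
  rw [pathClique, SimpleGraph.fromRel_adj] at h
  by_cases hL : L ≤ u.val ∧ L ≤ v.val
  · have := half_pow_le (show L - i ≤ (i - v.val) + (v.val - i) by omega)
    have := h0 ((i - u.val) + (u.val - i))
    unfold pathWeight
    linarith
  · have h1 := half_pow_le
      (show (i - u.val) + (u.val - i) ≤ (i - v.val) + (v.val - i) + 1 by omega)
    rw [pow_succ] at h1
    have := h0 (L - i)
    unfold pathWeight
    linarith

theorem sum_half_pow_right_le (n i K : ℕ) :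
    ∑ j ∈ range n, (if i + K < j then (1 / 2 : ℝ) ^ (j - i) else 0) ≤ (1 / 2) ^ K := by
  suffices h : ∑ j ∈ range n, (if i + K < j then (1 / 2 : ℝ) ^ (j - i) else 0) ≤
      (1 / 2) ^ K - (1 / 2) ^ (max (n - 1 - i) K) by
    have : (0 : ℝ) ≤ (1 / 2) ^ (max (n - 1 - i) K) := by positivity
    linarith
  induction n with
  | zero => simp
  | succ n ih =>
    rw [sum_range_succ]
    split_ifs with h
    · rw [show max (n + 1 - 1 - i) K = (n - 1 - i) + 1 by omega,
        show n - i = n - 1 - i + 1 by omega]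
      rw [show max (n - 1 - i) K = n - 1 - i by omega] at ih
      rw [pow_succ]
      linarith
    · rw [show max (n + 1 - 1 - i) K = max (n - 1 - i) K by omega]
      linarith

theorem sum_half_pow_left_le (n i K : ℕ) :
    ∑ j ∈ range n, (if j + K < i then (1 / 2 : ℝ) ^ (i - j) else 0) ≤ (1 / 2) ^ K := by
  suffices h : ∑ j ∈ range n, (if j + K < i then (1 / 2 : ℝ) ^ (i - j) else 0) ≤
      (1 / 2) ^ (max K (i - n)) from h.trans (half_pow_le (le_max_left _ _))
  induction n with
  | zero => simp
  | succ n ih =>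
    rw [sum_range_succ]
    split_ifs with h
    · rw [show max K (i - n) = i - n by omega] at ih
      rw [show max K (i - (n + 1)) = i - n - 1 by omega]
      have : (1 / 2 : ℝ) ^ (i - n) = (1 / 2) ^ (i - n - 1) * (1 / 2) := by
        rw [← pow_succ, show i - n - 1 + 1 = i - n by omega]
      linarith
    · rw [show max K (i - (n + 1)) = max K (i - n) by omega]
      linarith

/-- The window of `2 * K + 1` vertices of index `k` along the path. -/
def window (n K k : ℕ) : Finset (Fin n) :=
  univ.filter fun j => k * (2 * K + 1) ≤ j.val ∧ j.val < (k + 1) * (2 * K + 1)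

theorem card_window {n K k : ℕ} (h : (k + 1) * (2 * K + 1) ≤ n) :
    (window n K k).card = 2 * K + 1 := by
  have hw : window n K k = (Ico (k * (2 * K + 1)) ((k + 1) * (2 * K + 1))).attachFin
      (fun j hj => (mem_Ico.1 hj).2.trans_le h) := by
    ext j
    simp [window, mem_attachFin]
  rw [hw, card_attachFin, Nat.card_Ico, add_mul, one_mul, Nat.add_sub_cancel_left]

theorem disjoint_window {n K k l : ℕ} (h : k ≠ l) : Disjoint (window n K k) (window n K l) := by
  rw [disjoint_left]
  intro j hj hj'
  simp only [window, mem_filter, mem_univ, true_and] at hj hj'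
  have h1 : k < l + 1 := lt_of_mul_lt_mul_right (hj.1.trans_lt hj'.2) (Nat.zero_le _)
  have h2 : l < k + 1 := lt_of_mul_lt_mul_right (hj'.1.trans_lt hj.2) (Nat.zero_le _)
  omega

theorem sum_pathWeight_compl_window_le (n L K k : ℕ) :
    ∑ j ∈ (window n K k)ᶜ, pathWeight L (k * (2 * K + 1) + K) j ≤
      2 * (1 / 2) ^ K + n * (1 / 2) ^ (L - (k * (2 * K + 1) + K)) := by
  set i := k * (2 * K + 1) + K with hi
  have h1 : ∑ j ∈ (window n K k)ᶜ, (1 / 2 : ℝ) ^ ((i - j.val) + (j.val - i)) ≤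
      ∑ j : Fin n, ((if i + K < j.val then (1 / 2 : ℝ) ^ (j.val - i) else 0) +
        (if j.val + K < i then (1 / 2 : ℝ) ^ (i - j.val) else 0)) := by
    refine (sum_le_sum fun j hj => ?_).trans
      (sum_le_sum_of_subset_of_nonneg (subset_univ _) fun j _ _ => ?_)
    · simp only [window, mem_compl, mem_filter, mem_univ, true_and, not_and, not_lt, add_mul,
        one_mul] at hj
      by_cases h : k * (2 * K + 1) ≤ j.val
      · have := hj h
        rw [if_pos (by omega), if_neg (by omega), show i - j.val = 0 by omega, zero_add, add_zero]
      · rw [if_neg (by omega), if_pos (by omega), show j.val - i = 0 by omega, zero_add, add_zero]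
    · positivity
  rw [sum_add_distrib,
    Fin.sum_univ_eq_sum_range (fun j => if i + K < j then (1 / 2 : ℝ) ^ (j - i) else 0),
    Fin.sum_univ_eq_sum_range (fun j => if j + K < i then (1 / 2 : ℝ) ^ (i - j) else 0)] at h1
  have h2 := sum_half_pow_right_le n i K
  have h3 := sum_half_pow_left_le n i K
  have h4 : ∑ j ∈ (window n K k)ᶜ, (1 / 2 : ℝ) ^ (L - i) ≤ n * (1 / 2) ^ (L - i) := by
    rw [sum_const, nsmul_eq_mul]
    gcongr
    simpa using card_le_univ (window n K k)ᶜ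
  simp only [pathWeight, sum_add_distrib]
  linarith

/-- Configurations vanishing on the window `k` that are light as seen from its centre. -/
noncomputable def lightConfigs (n L K t k : ℕ) : Finset (Fin n → ℕ) :=
  ((window n K k)ᶜ.piAntidiag t).filter fun C =>
    ∑ j : Fin n, pathWeight L (k * (2 * K + 1) + K) j * (C j : ℝ) < 1

theorem not_solvable_of_mem_lightConfigs {n L K t k : ℕ} (hn : k * (2 * K + 1) + K < n)
    (hL : k * (2 * K + 1) + K ≤ L) {C : Fin n → ℕ} (hC : C ∈ lightConfigs n L K t k) :
    ¬ Solvable (pathClique n L) C := fun h =>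
  (mem_filter.1 hC).2.not_ge <| one_le_weight_of_solvable
    (w := fun j : Fin n => pathWeight L (k * (2 * K + 1) + K) j) (fun _ => pathWeight_nonneg _ _ _)
    (fun _ _ huv => pathWeight_le_two_mul hL huv) (v := ⟨_, hn⟩) (one_le_pathWeight_self _ _) h

theorem card_lightConfigs_ge {n L K t k : ℕ} {c : ℝ} (hn : 2 * (2 * K + 1) < n)
    (hk : (k + 1) * (2 * K + 1) ≤ n) (ht : (t : ℝ) ≤ c * n)
    (hc : 2 * c * (2 * (1 / 2) ^ K + n * (1 / 2) ^ (L - (k * (2 * K + 1) + K))) ≤ 1 / 8) :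
    7 / 8 * (((n - (2 * K + 1) + t - 1).choose t : ℕ) : ℝ) ≤ (lightConfigs n L K t k).card := by
  set i := k * (2 * K + 1) + K with hi
  set s := 2 * K + 1 with hs
  set S := (window n K k)ᶜ with hS
  have hcard : S.card = n - s := by
    rw [hS, card_compl, Fintype.card_fin, card_window hk]
  set A := S.piAntidiag t with hA
  have hZ : A.card = (n - s + t - 1).choose t := by rw [hA, card_piAntidiag_nat, hcard]
  rw [← hZ]
  set f : (Fin n → ℕ) → ℝ := fun C => ∑ j : Fin n, pathWeight L i j * (C j : ℝ) with hf
  have hsplit : (lightConfigs n L K t k).card + (A.filter fun C => ¬ f C < 1).card = A.card :=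
    card_filter_add_card_filter_not (s := A) (fun C => f C < 1)
  have hf0 (C : Fin n → ℕ) : 0 ≤ f C :=
    sum_nonneg fun j _ => mul_nonneg (pathWeight_nonneg _ _ _) (Nat.cast_nonneg _)
  have hmarkov : ((A.filter fun C => ¬ f C < 1).card : ℝ) ≤ ∑ C ∈ A, f C := by
    calc ((A.filter fun C => ¬ f C < 1).card : ℝ)
        = ∑ C ∈ A.filter fun C => ¬ f C < 1, (1 : ℝ) := by simp
      _ ≤ ∑ C ∈ A.filter fun C => ¬ f C < 1, f C :=
          sum_le_sum fun C hC => not_lt.1 (mem_filter.1 hC).2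
      _ ≤ ∑ C ∈ A, f C := sum_le_sum_of_subset_of_nonneg (filter_subset _ _) fun C _ _ => hf0 C
  have hnR : (0 : ℝ) < n := by exact_mod_cast (show 0 < n by omega)
  have hc0 : 0 ≤ c := by
    by_contra! h
    have : (0 : ℝ) ≤ t := Nat.cast_nonneg _
    nlinarith
  have hns : (n : ℝ) ≤ 2 * (n - s : ℕ) := by exact_mod_cast (show n ≤ 2 * (n - s) by omega)
  have hns0 : (0 : ℝ) < (n - s : ℕ) := by linarith
  have hsum : ∑ C ∈ A, f C ≤ 2 * c * (∑ j ∈ S, pathWeight L i j) * A.card := by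
    have h1 (C : Fin n → ℕ) (hC : C ∈ A) : f C = ∑ j ∈ S, pathWeight L i j * (C j : ℝ) := by
      refine (sum_subset (subset_univ S) fun j _ hj => ?_).symm
      have : C j = 0 := by
        by_contra h
        exact hj ((mem_piAntidiag.1 hC).2 j h)
      simp [this]
    rw [sum_congr rfl h1, sum_comm, mul_assoc, sum_mul, mul_sum]
    refine sum_le_sum fun j hj => ?_
    rw [← mul_sum]
    have h2 : ((n - s : ℕ) : ℝ) * ∑ C ∈ A, (C j : ℝ) = t * A.card := by
      have := card_mul_sum_piAntidiag S t hj
      rw [hcard] at this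
      exact_mod_cast this
    have h3 : ∑ C ∈ A, (C j : ℝ) ≤ 2 * c * A.card := by
      refine le_of_mul_le_mul_left ?_ hns0
      rw [h2]
      have hA0 : (0 : ℝ) ≤ A.card := Nat.cast_nonneg _
      calc (t : ℝ) * A.card ≤ (c * (2 * (n - s : ℕ))) * A.card := by
            gcongr
            exact ht.trans (by gcongr)
        _ = _ := by ring
    calc _ ≤ pathWeight L i j * (2 * c * A.card) := by
          gcongr
          exact pathWeight_nonneg _ _ _
      _ = _ := by ring
  have h8 : 2 * c * (∑ j ∈ S, pathWeight L i j) ≤ 1 / 8 :=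
    (mul_le_mul_of_nonneg_left (sum_pathWeight_compl_window_le n L K k) (by positivity)).trans hc
  have hfin := mul_le_mul_of_nonneg_right h8 (Nat.cast_nonneg (α := ℝ) A.card)
  have hsplit' : ((lightConfigs n L K t k).card : ℝ) + (A.filter fun C => ¬ f C < 1).card =
      A.card := by exact_mod_cast hsplit
  linarith

theorem solvableProportion_lt_half {n L K m t : ℕ} {c : ℝ} (hn : 2 * (2 * K + 1) < n)
    (hmn : m * (2 * K + 1) ≤ n) (hmL : m * (2 * K + 1) ≤ L) (ht : (t : ℝ) ≤ c * n)
    (hm : 8 * (1 + 2 * c) ^ (2 * K + 1) ≤ m)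
    (hc : 2 * c * (2 * (1 / 2) ^ K + n * (1 / 2) ^ (L - m * (2 * K + 1))) ≤ 1 / 8) :
    solvableProportion n (pathClique n L) t < 1 / 2 := by
  classical
  have hblock (k : ℕ) (hk : k ∈ range m) : (k + 1) * (2 * K + 1) ≤ m * (2 * K + 1) :=
    Nat.mul_le_mul_right _ (mem_range.1 hk)
  have hcentre (k : ℕ) (hk : k ∈ range m) : k * (2 * K + 1) + K < m * (2 * K + 1) := by
    have := hblock k hk
    rw [add_mul, one_mul] at this
    omega
  set s := 2 * K + 1 with hs
  have hnR : (0 : ℝ) < n := by exact_mod_cast (show 0 < n by omega)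
  have hc0 : 0 ≤ c := by
    by_contra! h
    have : (0 : ℝ) ≤ t := Nat.cast_nonneg _
    nlinarith
  set T := (n + t - 1).choose t with hT
  set Z := (n - s + t - 1).choose t with hZ
  set Y := (n - 2 * s + t - 1).choose t with hY
  have hT0 : (0 : ℝ) < T := by exact_mod_cast choose_parts_pos (by omega) t
  have hZ0 : (0 : ℝ) < Z := by exact_mod_cast choose_parts_pos (by omega) t
  have hYT : (Y : ℝ) * T ≤ Z * Z := by
    have := choose_parts_mul_le (a := n - 2 * s) (b := n - s) (by omega) (by omega) t s
    rw [show n - s + s = n by omega, show n - 2 * s + s = n - s by omega] at this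
    exact_mod_cast this
  have hTZ : (T : ℝ) ≤ (1 + 2 * c) ^ s * Z := by
    have hns : (n : ℝ) ≤ 2 * (n - s : ℕ) := by exact_mod_cast (show n ≤ 2 * (n - s) by omega)
    have := pow_mul_choose_parts_le (a := n - s) (t := t) (D := 1 + 2 * c) (by omega)
      (by nlinarith) s
    rwa [show n - s + s = n by omega] at this
  have hTm : 8 * (T : ℝ) ≤ m * Z := by
    have := mul_le_mul_of_nonneg_right hm hZ0.le
    linarith
  set U := (range m).biUnion (lightConfigs n L K t) with hU
  have hmass : 7 / 8 * (m * Z : ℝ) ≤ ∑ k ∈ range m, ((lightConfigs n L K t k).card : ℝ) := by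
    have h1 : ∑ k ∈ range m, (7 / 8 * (Z : ℝ)) ≤
        ∑ k ∈ range m, ((lightConfigs n L K t k).card : ℝ) := by
      refine sum_le_sum fun k hk => card_lightConfigs_ge hn ((hblock k hk).trans hmn) ht ?_
      refine le_trans ?_ hc
      gcongr 2 * c * (2 * (1 / 2) ^ K + n * ?_)
      exact half_pow_le (Nat.sub_le_sub_left (hcentre k hk).le L)
    rw [sum_const, card_range, nsmul_eq_mul] at h1
    linarith
  have hpair : ∑ k ∈ range m, ∑ l ∈ range m,
      ((lightConfigs n L K t k ∩ lightConfigs n L K t l).card : ℝ) ≤ m * Z + m * m * Y := by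
    have h1 (k : ℕ) (hk : k ∈ range m) (l : ℕ) (hl : l ∈ range m) :
        ((lightConfigs n L K t k ∩ lightConfigs n L K t l).card : ℝ) ≤
          (if k = l then (Z : ℝ) else 0) + Y := by
      have hsub : lightConfigs n L K t k ∩ lightConfigs n L K t l ⊆
          ((window n K k)ᶜ ∩ (window n K l)ᶜ).piAntidiag t := by
        rw [← piAntidiag_inter]
        exact inter_subset_inter (filter_subset _ _) (filter_subset _ _)
      have hle := card_le_card hsub
      rw [card_piAntidiag_nat, ← compl_union, card_compl, Fintype.card_fin] at hle
      split_ifs with h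
      · subst h
        rw [union_self, card_window ((hblock k hk).trans hmn)] at hle
        have : ((lightConfigs n L K t k ∩ lightConfigs n L K t k).card : ℝ) ≤ Z := by
          exact_mod_cast hle
        have : (0 : ℝ) ≤ Y := Nat.cast_nonneg _
        linarith
      · rw [card_union_of_disjoint (disjoint_window h), card_window ((hblock k hk).trans hmn),
          card_window ((hblock l hl).trans hmn), ← two_mul] at hle
        rw [zero_add]
        exact_mod_cast hle
    refine (sum_le_sum fun k hk => sum_le_sum fun l hl => h1 k hk l hl).trans_eq ?_
    have h2 (k : ℕ) (hk : k ∈ range m) :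
        ∑ l ∈ range m, ((if k = l then (Z : ℝ) else 0) + Y) = Z + m * Y := by
      rw [sum_add_distrib, sum_ite_eq, if_pos hk, sum_const, card_range, nsmul_eq_mul]
    rw [sum_congr rfl h2, sum_const, card_range, nsmul_eq_mul]
    ring
  have hCS : (∑ k ∈ range m, ((lightConfigs n L K t k).card : ℝ)) ^ 2 ≤
      U.card * ∑ k ∈ range m, ∑ l ∈ range m,
        ((lightConfigs n L K t k ∩ lightConfigs n L K t l).card : ℝ) := by
    exact_mod_cast sq_sum_card_le_card_biUnion (range m) (lightConfigs n L K t)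
  have hUT : (T : ℝ) < 2 * U.card := by
    set x : ℝ := m * Z with hx
    have hx0 : 0 < x := by linarith
    have hU0 : (0 : ℝ) ≤ U.card := Nat.cast_nonneg _
    have h1 : (7 / 8 * x) ^ 2 ≤ U.card * (x + m * m * Y) :=
      (pow_le_pow_left₀ (by positivity) hmass 2).trans
        (hCS.trans (mul_le_mul_of_nonneg_left hpair hU0))
    have h2 : (m * m * Y : ℝ) * T ≤ x * x := by
      calc (m * m * Y : ℝ) * T = m * m * (Y * T) := by ring
        _ ≤ m * m * (Z * Z) := by gcongr
        _ = x * x := by ring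
    have h3 : (7 / 8 * x) ^ 2 * T ≤ U.card * (x * (T + x)) := by
      calc (7 / 8 * x) ^ 2 * T ≤ U.card * (x + m * m * Y) * T := by gcongr
        _ = U.card * (x * T + m * m * Y * T) := by ring
        _ ≤ U.card * (x * T + x * x) := by gcongr
        _ = _ := by ring
    have h4 : 49 / 64 * x * T ≤ U.card * (T + x) := by
      refine le_of_mul_le_mul_left ?_ hx0
      linarith
    have h5 : 49 / 64 * x * T ≤ U.card * (9 / 8 * x) :=
      h4.trans (mul_le_mul_of_nonneg_left (by linarith) hU0)
    have h6 : 49 / 64 * (T : ℝ) ≤ U.card * (9 / 8) := by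
      refine le_of_mul_le_mul_left ?_ hx0
      linarith
    linarith
  have hdisj : Disjoint ((configs n t).filter fun C => Solvable (pathClique n L) C) U := by
    rw [disjoint_left]
    intro C hC hCU
    obtain ⟨k, hk, hCk⟩ := mem_biUnion.1 hCU
    exact not_solvable_of_mem_lightConfigs ((hcentre k hk).trans_le hmn)
      ((hcentre k hk).le.trans hmL) hCk (mem_filter.1 hC).2
  have hsub : ((configs n t).filter fun C => Solvable (pathClique n L) C) ∪ U ⊆ configs n t := by
    refine union_subset (filter_subset _ _) (biUnion_subset.2 fun k _ C hC => ?_)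
    have hC' := (mem_filter.1 hC).1
    rw [← inter_univ (window n K k)ᶜ, ← piAntidiag_inter, mem_inter] at hC'
    rw [configs_eq_piAntidiag]
    exact hC'.2
  have hle := card_le_card hsub
  rw [card_union_of_disjoint hdisj, configs_eq_piAntidiag, card_piAntidiag_nat, card_univ,
    Fintype.card_fin, ← configs_eq_piAntidiag] at hle
  have hle' : (((configs n t).filter fun C => Solvable (pathClique n L) C).card : ℝ) + U.card ≤ T :=
    by exact_mod_cast hle
  rw [solvableProportion, div_lt_iff₀ hT0]
  linarith

end Threshold

section Asymptotics

theorem natCast_mul_logb_le_two_pow {n : ℕ} (hn : 2 < n) :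
    (n : ℝ) * Real.logb 2 n ≤ 2 ^ (⌊Real.logb 2 n + Real.logb 2 (Real.logb 2 n)⌋₊ + 1) := by
  have hn0 : (0 : ℝ) < n := by exact_mod_cast (show 0 < n by omega)
  have hlog : 0 < Real.logb 2 n :=
    Real.logb_pos (by norm_num) (by exact_mod_cast (show 1 < n by omega))
  have hlt := Nat.lt_floor_add_one (Real.logb 2 n + Real.logb 2 (Real.logb 2 n))
  calc (n : ℝ) * Real.logb 2 n
      = 2 ^ (Real.logb 2 n + Real.logb 2 (Real.logb 2 n)) := by
        rw [Real.rpow_add (by norm_num), Real.rpow_logb (by norm_num) (by norm_num) hn0,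
          Real.rpow_logb (by norm_num) (by norm_num) hlog]
    _ ≤ 2 ^ ((⌊Real.logb 2 n + Real.logb 2 (Real.logb 2 n)⌋₊ + 1 : ℕ) : ℝ) :=
        Real.rpow_le_rpow_of_exponent_le (by norm_num) (by push_cast; exact hlt.le)
    _ = _ := Real.rpow_natCast _ _

theorem eventually_forall_solvableProportion_lt_half {c : ℝ} (hc : 0 < c) :
    ∀ᶠ n : ℕ in Filter.atTop, ∀ t : ℕ, (t : ℝ) ≤ c * n →
      solvableProportion n
        (pathClique n ⌊Real.logb 2 n + Real.logb 2 (Real.logb 2 n)⌋₊) t < 1 / 2 := by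
  obtain ⟨K, hK⟩ := exists_pow_lt_of_lt_one (show 0 < 1 / (64 * c) by positivity)
    (show (1 / 2 : ℝ) < 1 by norm_num)
  obtain ⟨m, hm⟩ := exists_nat_ge (8 * (1 + 2 * c) ^ (2 * K + 1))
  set M := m * (2 * K + 1) with hM
  have hlog : Filter.Tendsto (fun n : ℕ => Real.logb 2 n) Filter.atTop Filter.atTop :=
    (Real.tendsto_logb_atTop (by norm_num)).comp tendsto_natCast_atTop_atTop
  filter_upwards [hlog.eventually_ge_atTop 1, hlog.eventually_ge_atTop (64 * c * 2 ^ M),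
    Filter.eventually_gt_atTop 2, Filter.eventually_ge_atTop (2 ^ (M + 1)),
    Filter.eventually_gt_atTop (2 * (2 * K + 1))] with n h1 hA h2 hnM hnK t ht
  have hpow := natCast_mul_logb_le_two_pow h2
  set L := ⌊Real.logb 2 n + Real.logb 2 (Real.logb 2 n)⌋₊
  have hn0 : (0 : ℝ) < n := by exact_mod_cast (show 0 < n by omega)
  have hML : M ≤ L := by
    have h3 : (2 : ℝ) ^ (M + 1) ≤ 2 ^ (L + 1) := by
      refine le_trans ?_ ((le_mul_of_one_le_right hn0.le h1).trans hpow)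
      exact_mod_cast hnM
    have := (pow_le_pow_iff_right₀ (by norm_num : (1 : ℝ) < 2)).1 h3
    omega
  have hMn : M ≤ n := by
    have := (M + 1).lt_two_pow_self
    omega
  refine solvableProportion_lt_half hnK hMn hML ht hm ?_
  have hK' : c * (1 / 2 : ℝ) ^ K ≤ 1 / 64 := by
    have := mul_le_mul_of_nonneg_left hK.le hc.le
    rwa [show c * (1 / (64 * c)) = 1 / 64 by field_simp] at this
  have hL' : c * (n * (1 / 2 : ℝ) ^ (L - M)) ≤ 1 / 32 := by
    obtain ⟨d, hd⟩ : ∃ d, L = M + d := ⟨L - M, by omega⟩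
    rw [hd] at hpow ⊢
    rw [Nat.add_sub_cancel_left, one_div, inv_pow]
    have h3 : (n : ℝ) * (64 * c * 2 ^ M) ≤ 2 ^ (M + d + 1) :=
      (mul_le_mul_of_nonneg_left hA hn0.le).trans hpow
    have h4 : (2 : ℝ) ^ (M + d + 1) = 2 ^ M * (2 * 2 ^ d) := by ring
    have h5 : 64 * (c * n) ≤ 2 * 2 ^ d := by
      refine le_of_mul_le_mul_left ?_ (show (0 : ℝ) < 2 ^ M by positivity)
      rw [← h4]
      linarith
    rw [← mul_assoc, ← div_eq_mul_inv, div_le_iff₀ (by positivity)]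
    linarith
  linarith

end Asymptotics

/-- For the modified graph `G'_n` whose path has
`⌊log₂ n + log₂ log₂ n⌋` vertices, the threshold satisfies `τ_{1/2}(G'_n)/n → ∞`;
that is, for every `c > 0`, for all sufficiently large `n` the proportion of solvable
configurations of size `⌊cn⌋` on `G'_n` is less than `1/2`. -/
theorem modified_Ggraph_threshold_superlinear :
    Filter.Tendsto (fun n : ℕ =>
        (tauAlpha n (pathClique n ⌊Real.logb 2 n + Real.logb 2 (Real.logb 2 n)⌋₊)
            (1 / 2) : ℝ) / (n : ℝ))
        Filter.atTop Filter.atTop ∧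
      ∀ c : ℝ, 0 < c →
        ∀ᶠ n : ℕ in Filter.atTop,
          solvableProportion n
              (pathClique n ⌊Real.logb 2 n + Real.logb 2 (Real.logb 2 n)⌋₊)
              ⌊c * (n : ℝ)⌋₊ < 1 / 2 := by
  refine ⟨Filter.tendsto_atTop.2 fun b => ?_, fun c hc => ?_⟩
  · filter_upwards [eventually_forall_solvableProportion_lt_half (c := max b 1) (by positivity),
      Filter.eventually_ge_atTop 1] with n hlt hn
    have hn0 : (0 : ℝ) < n := by exact_mod_cast hn
    rw [le_div_iff₀ hn0]
    by_contra! h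
    refine (hlt _ (h.le.trans (by gcongr; exact le_max_left _ _))).not_ge ?_
    refine Nat.sInf_mem (s := {t : ℕ | (1 / 2 : ℝ) ≤ solvableProportion n _ t})
      ⟨n * 2 ^ n, ?_⟩
    rw [Set.mem_ofPred_eq, solvableProportion_eq_one hn (pathClique_preconnected _ _)]
    norm_num
  · filter_upwards [eventually_forall_solvableProportion_lt_half hc] with n hlt
    exact hlt _ (Nat.floor_le (by positivity))
end
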